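/- Let s ≥ 2 and Γ = Γ_{2,2,s} = Γ_{2,2} ∪ {1 2 ⋯ s (s+1)}. Then U_{Γ,1}(y) = −y, and for all n ≥ 2, U_{Γ,n}(y) = −y·U_{Γ,n−1}(y) − Σ_{k=0}^{s−2} [ (n−k−1)·y·U_{Γ,n−k−2}(y) + (n−k−2)·y²·U_{Γ,n−k−3}(y) ]. -/

import Mathlib

open Polynomial

/-- The reduction of a list of distinct integers: replace the i-th smallest entry by i. -/
def redL (l : List ℕ) : List ℕ :=
  l.map (fun x => (l.countP (fun y => decide (y < x))) + 1)

/-- The number of descents of a list. -/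
def desL (l : List ℕ) : ℕ :=
  (l.zip l.tail).countP (fun p => decide (p.2 < p.1))

/-- `σ` has a `Γ`-match: some consecutive factor of length at least 2 reduces to a member of `Γ`. -/
def HasMatch (Γ : Set (List ℕ)) (l : List ℕ) : Prop :=
  ∃ i j : ℕ, 1 ≤ j ∧ i + j + 1 ≤ l.length ∧ redL ((l.drop i).take (j + 1)) ∈ Γ

open scoped Classical in
/-- The set of permutations of `{1,…,n}` (in one-line notation, as lists) with no `Γ`-match. -/
noncomputable def NMfinset (Γ : Set (List ℕ)) (n : ℕ) : Finset (List ℕ) :=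
  ((List.range' 1 n).permutations.toFinset).filter (fun l => ¬ HasMatch Γ l)

/-- `NM_{Γ,n}(y) = Σ_{σ ∈ NM_n(Γ)} y^{1+des(σ)}` for `n ≥ 1`, and `NM_{Γ,0}(y) = 1`. -/
noncomputable def NMpoly (Γ : Set (List ℕ)) (n : ℕ) : Polynomial ℚ :=
  if n = 0 then 1 else ∑ l ∈ NMfinset Γ n, X ^ (1 + desL l)


/-! ### Lists on a finite set -/

/-- All arrangements of the elements of `S`. -/
noncomputable def Lst (S : Finset ℕ) : Finset (List ℕ) := S.toList.permutations.toFinset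

lemma mem_Lst (S : Finset ℕ) (l : List ℕ) : l ∈ Lst S ↔ l.Nodup ∧ l.toFinset = S := by
  unfold Lst
  rw [List.mem_toFinset, List.mem_permutations]
  constructor
  · intro h
    refine ⟨h.nodup_iff.2 S.nodup_toList, ?_⟩
    rw [List.toFinset_eq_of_perm _ _ h, Finset.toList_toFinset]
  · rintro ⟨h, rfl⟩
    exact (List.perm_ext_iff_of_nodup h (Finset.nodup_toList _)).2 (by simp)

lemma Lst_Icc (n : ℕ) : (List.range' 1 n).permutations.toFinset = Lst (Finset.Icc 1 n) := by
  ext l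
  rw [mem_Lst, List.mem_toFinset, List.mem_permutations]
  have hF : (List.range' 1 n).toFinset = Finset.Icc 1 n := by
    ext x; simp [List.mem_range'_1]; omega
  constructor
  · intro h
    refine ⟨h.nodup_iff.2 List.nodup_range', ?_⟩
    rw [List.toFinset_eq_of_perm _ _ h, hF]
  · rintro ⟨h, h2⟩
    refine (List.perm_ext_iff_of_nodup h List.nodup_range').2 (fun a => ?_)
    rw [← List.mem_toFinset, h2, ← hF, List.mem_toFinset]

/-- Structural form of avoidance. -/
def Av (s : ℕ) (l : List ℕ) : Prop :=
  (∀ i, i + 3 < l.length → ¬ (l.getD i 0 < l.getD (i+1) 0 ∧ l.getD (i+2) 0 < l.getD (i+1) 0 ∧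
    l.getD (i+2) 0 < l.getD (i+3) 0 ∧ l.getD i 0 < l.getD (i+2) 0)) ∧
  ∀ i, i + s < l.length → ∃ j < s, l.getD (i+j+1) 0 ≤ l.getD (i+j) 0

lemma redL_four (a b c d : ℕ) (h : [a,b,c,d].Nodup) :
    (redL [a,b,c,d] = [1,3,2,4] ∨ redL [a,b,c,d] = [1,4,2,3]) ↔
      (a < b ∧ c < b ∧ c < d ∧ a < c) := by
  have h1 : a ≠ b ∧ a ≠ c ∧ a ≠ d ∧ b ≠ c ∧ b ≠ d ∧ c ≠ d := by
    simp at h; tauto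
  simp only [redL, List.map_cons, List.map_nil, List.countP_cons, List.countP_nil,
    List.cons.injEq, decide_eq_true_eq, and_true, lt_irrefl, if_false]
  have key : ∀ x y : ℕ, x ≠ y →
      (x < y ∧ (if x < y then 1 else 0) = 1 ∧ (if y < x then 1 else 0) = 0) ∨
      (y < x ∧ (if x < y then 1 else 0) = 0 ∧ (if y < x then 1 else 0) = 1) := by
    intro x y hxy
    rcases lt_or_gt_of_ne hxy with h | h
    · left; simp [h, h.le]
    · right; simp [h, h.le]
  obtain ⟨n1, n2, n3, n4, n5, n6⟩ := h1
  have k1 := key _ _ n1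
  have k2 := key _ _ n2
  have k3 := key _ _ n3
  have k4 := key _ _ n4
  have k5 := key _ _ n5
  have k6 := key _ _ n6
  generalize (if a < b then 1 else 0) = x1 at *
  generalize (if b < a then 1 else 0) = x2 at *
  generalize (if a < c then 1 else 0) = x3 at *
  generalize (if c < a then 1 else 0) = x4 at *
  generalize (if a < d then 1 else 0) = x5 at *
  generalize (if d < a then 1 else 0) = x6 at *
  generalize (if b < c then 1 else 0) = x7 at *
  generalize (if c < b then 1 else 0) = x8 at *
  generalize (if b < d then 1 else 0) = x9 at *
  generalize (if d < b then 1 else 0) = x10 at *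
  generalize (if c < d then 1 else 0) = x11 at *
  generalize (if d < c then 1 else 0) = x12 at *
  clear key h n1 n2 n3 n4 n5 n6
  rcases k1 with ⟨k1, rfl, rfl⟩ | ⟨k1, rfl, rfl⟩ <;> rcases k2 with ⟨k2, rfl, rfl⟩ | ⟨k2, rfl, rfl⟩ <;>
  rcases k3 with ⟨k3, rfl, rfl⟩ | ⟨k3, rfl, rfl⟩ <;> rcases k4 with ⟨k4, rfl, rfl⟩ | ⟨k4, rfl, rfl⟩ <;>
  rcases k5 with ⟨k5, rfl, rfl⟩ | ⟨k5, rfl, rfl⟩ <;> rcases k6 with ⟨k6, rfl, rfl⟩ | ⟨k6, rfl, rfl⟩ <;>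
  omega

lemma redL_inc (s : ℕ) (w : List ℕ) (hw : w.length = s + 1) :
    redL w = List.range' 1 (s+1) ↔ ∀ j < s, w.getD j 0 < w.getD (j+1) 0 := by
  have key : redL w = List.range' 1 (s+1) ↔ ∀ i, (hi : i < s + 1) →
      w.countP (fun y => decide (y < w.getD i 0)) = i := by
    constructor
    · intro h i hi
      have : (redL w)[i]? = (List.range' 1 (s+1))[i]? := by rw [h]
      rw [List.getElem?_range' hi] at this
      simp only [redL, List.getElem?_map] at this
      rw [List.getElem?_eq_getElem (by omega)] at this
      simp only [Option.map_some, Option.some.injEq] at this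
      rw [List.getD_eq_getElem _ _ (by omega)]
      omega
    · intro h
      apply List.ext_getElem
      · simp [redL, hw]
      · intro i h1 h2
        have hi : i < s + 1 := by simpa using h2
        have := h i hi
        rw [List.getD_eq_getElem _ _ (by omega)] at this
        simp only [redL, List.getElem_map, List.getElem_range', this]
        omega
  rw [key]
  constructor
  · intro h j hj
    by_contra hc
    have h1 := h j (by omega)
    have h2 := h (j+1) (by omega)
    have : w.countP (fun y => decide (y < w.getD (j+1) 0)) ≤
        w.countP (fun y => decide (y < w.getD j 0)) := by
      apply List.countP_mono_left
      intro x _ hx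
      simp only [decide_eq_true_eq] at hx ⊢
      omega
    omega
  · intro h i hi
    have mono : ∀ b, b < s + 1 → ∀ a < b, w.getD a 0 < w.getD b 0 := by
      intro b
      induction b with
      | zero => intro _ a ha; omega
      | succ b ih =>
        intro hb a ha
        have := h b (by omega)
        rcases Nat.lt_succ_iff_lt_or_eq.1 ha with h1 | h1
        · exact (ih (by omega) a h1).trans this
        · subst h1; exact this
    conv_lhs => rw [← List.take_append_drop i w]
    rw [List.countP_append]
    have e1 : (w.take i).countP (fun y => decide (y < (w.take i ++ w.drop i).getD i 0)) = i := by
      rw [List.take_append_drop]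
      rw [List.countP_eq_length.2]
      · simp; omega
      · intro x hx
        obtain ⟨a, ha, rfl⟩ := List.getElem_of_mem hx
        have ha' : a < i := by simp at ha; omega
        have := mono i hi a ha'
        rw [List.getD_eq_getElem _ _ (by omega)] at this
        simpa using this
    have e2 : (w.drop i).countP (fun y => decide (y < (w.take i ++ w.drop i).getD i 0)) = 0 := by
      rw [List.take_append_drop]
      rw [List.countP_eq_zero]
      intro x hx
      obtain ⟨a, ha, rfl⟩ := List.getElem_of_mem hx
      have ha' : i + a < s + 1 := by simp at ha; omega
      rw [List.getElem_drop]
      simp only [decide_eq_true_eq, not_lt]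
      rcases Nat.eq_zero_or_pos a with h0 | h0
      · subst h0
        rw [List.getD_eq_getElem _ _ (by omega)]
        simp
      · have := mono (i+a) ha' i (by omega)
        rw [List.getD_eq_getElem _ _ (by omega : i + a < w.length)] at this
        exact this.le
    rw [e1, e2]; rfl

lemma hasMatch_iff (s : ℕ) (hs : 2 ≤ s) (l : List ℕ) (hl : l.Nodup) :
    ¬ HasMatch {[1, 3, 2, 4], [1, 4, 2, 3], List.range' 1 (s + 1)} l ↔ Av s l := by
  have four : ∀ i, (hi : i + 3 < l.length) → (l.drop i).take (3+1) =
      [l.getD i 0, l.getD (i+1) 0, l.getD (i+2) 0, l.getD (i+3) 0] := by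
    intro i hi
    rw [List.drop_eq_getElem_cons (by omega), List.drop_eq_getElem_cons (by omega),
      List.drop_eq_getElem_cons (by omega), List.drop_eq_getElem_cons (by omega)]
    simp only [List.take_succ_cons, List.take_zero]
    rw [List.getD_eq_getElem _ _ (by omega), List.getD_eq_getElem _ _ (by omega),
      List.getD_eq_getElem _ _ (by omega), List.getD_eq_getElem _ _ (by omega)]
  have sub : ∀ i j : ℕ, ((l.drop i).take j).Nodup := fun i j =>
    (hl.sublist (List.drop_sublist i l)).sublist (List.take_sublist _ _)
  have gd : ∀ i j m : ℕ, m < j + 1 → ((l.drop i).take (j+1)).getD m 0 = l.getD (i+m) 0 := by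
    intro i j m hm
    simp [List.getD_eq_getElem?_getD, List.getElem?_take, hm]
  constructor
  · intro h
    constructor
    · intro i hi hc
      apply h
      refine ⟨i, 3, by omega, by omega, ?_⟩
      have hn := sub i (3+1)
      rw [four i hi] at hn ⊢
      have := (redL_four _ _ _ _ hn).2 hc
      simp only [Set.mem_insert_iff, Set.mem_singleton_iff]
      tauto
    · intro i hi
      by_contra hc
      push Not at hc
      apply h
      refine ⟨i, s, by omega, by omega, ?_⟩
      have : redL ((l.drop i).take (s+1)) = List.range' 1 (s+1) := by
        rw [redL_inc s _ (by simp; omega)]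
        intro j hj
        rw [gd _ _ _ (by omega), gd _ _ _ (by omega)]
        exact hc j hj
      rw [this]; simp
  · rintro ⟨h1, h2⟩ ⟨i, j, hj, hij, hm⟩
    have hlen : (redL ((l.drop i).take (j+1))).length = j + 1 := by
      simp [redL]; omega
    simp only [Set.mem_insert_iff, Set.mem_singleton_iff] at hm
    have h4 : (redL ((l.drop i).take (j+1)) = [1,3,2,4] ∨ redL ((l.drop i).take (j+1)) = [1,4,2,3])
        → False := by
      intro hm
      have : j = 3 := by
        rcases hm with hm | hm <;> (rw [hm] at hlen; simp at hlen; omega)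
      subst this
      have hn := sub i (3+1)
      rw [four i (by omega)] at hm hn
      exact h1 i (by omega) ((redL_four _ _ _ _ hn).1 hm)
    rcases hm with hm | hm | hm
    · exact h4 (Or.inl hm)
    · exact h4 (Or.inr hm)
    · have : j = s := by
        rw [hm] at hlen; simp at hlen; omega
      subst this
      rw [redL_inc j _ (by simp; omega)] at hm
      obtain ⟨m, hm1, hm2⟩ := h2 i (by omega)
      have := hm m hm1
      rw [gd _ _ _ (by omega), gd _ _ _ (by omega)] at this
      rw [← add_assoc] at this
      omega

/-! ### Runs -/

/-- The first brick `R` is allowed before a run starting with `a` (`big`: that run has length ≥ 2). -/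
def gd (R : Finset ℕ) (big : Prop) (a : ℕ) : Prop :=
  (∃ x ∈ R, a < x) ∧ (2 ≤ R.card → big → ∃ x ∈ R, ∃ z ∈ R, a < x ∧ x < z)

/-- `R` is allowed before the list `l`. -/
def goodL (R : Finset ℕ) (l : List ℕ) : Prop :=
  l ≠ [] → gd R (2 ≤ l.length ∧ l.getD 0 0 < l.getD 1 0) (l.getD 0 0)

lemma sorted_getD {r : List ℕ} (hr : r.Pairwise (· < ·)) {i j : ℕ} (hij : i < j)
    (hj : j < r.length) : r.getD i 0 < r.getD j 0 := by
  rw [List.getD_eq_getElem _ _ (by omega), List.getD_eq_getElem _ _ hj]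
  exact List.pairwise_iff_getElem.1 hr i j (by omega) hj hij

lemma getD_mem_toFinset {r : List ℕ} {i : ℕ} (hi : i < r.length) : r.getD i 0 ∈ r.toFinset := by
  rw [List.getD_eq_getElem _ _ hi]; simp

lemma exists_getD {r : List ℕ} {x : ℕ} (hx : x ∈ r.toFinset) : ∃ i < r.length, r.getD i 0 = x := by
  obtain ⟨a, ha, rfl⟩ := List.getElem_of_mem (List.mem_toFinset.1 hx)
  exact ⟨a, ha, List.getD_eq_getElem _ _ ha⟩

lemma gd_sorted {r : List ℕ} (hr : r.Pairwise (· < ·)) (big : Prop) (a : ℕ) (h0 : r ≠ []) :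
    gd r.toFinset big a ↔ a < r.getD (r.length - 1) 0 ∧
      (2 ≤ r.length → big → a < r.getD (r.length - 2) 0) := by
  have hc : r.toFinset.card = r.length :=
    List.toFinset_card_of_nodup (hr.imp (fun h => ne_of_lt h))
  have hpos : 0 < r.length := List.length_pos_iff.2 h0
  have le1 : ∀ i j, i ≤ j → j < r.length → r.getD i 0 ≤ r.getD j 0 := by
    intro i j hij hj
    rcases hij.eq_or_lt with h | h
    · rw [h]
    · exact (sorted_getD hr h hj).le
  unfold gd
  rw [hc]
  constructor
  · rintro ⟨⟨x, hx, hax⟩, h2⟩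
    constructor
    · obtain ⟨i, hi, rfl⟩ := exists_getD hx
      exact hax.trans_le (le1 _ _ (by omega) (by omega))
    · intro hl hb
      obtain ⟨x, hx, z, hz, h3, h4⟩ := h2 hl hb
      obtain ⟨i, hi, rfl⟩ := exists_getD hx
      obtain ⟨j, hj, rfl⟩ := exists_getD hz
      have : i < j := by
        by_contra hc
        have := le1 j i (by omega) hi
        omega
      exact h3.trans_le (le1 _ _ (by omega) (by omega))
  · rintro ⟨h1, h2⟩
    refine ⟨⟨_, getD_mem_toFinset (by omega), h1⟩, fun hl hb => ?_⟩
    exact ⟨_, getD_mem_toFinset (by omega : r.length - 2 < _), _,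
      getD_mem_toFinset (by omega : r.length - 1 < _), h2 hl hb,
      sorted_getD hr (by omega) (by omega)⟩

lemma Av_append (s : ℕ) (hs : 2 ≤ s) (r l : List ℕ) (hr : r.Pairwise (· < ·)) (h0 : r ≠ [])
    (hnd : (r ++ l).Nodup)
    (hj : l ≠ [] → l.getD 0 0 < r.getD (r.length - 1) 0) :
    Av s (r ++ l) ↔ r.length ≤ s ∧ Av s l ∧ goodL r.toFinset l := by
  have hpos : 0 < r.length := List.length_pos_iff.2 h0
  have A : ∀ i, i < r.length → (r ++ l).getD i 0 = r.getD i 0 := fun i hi =>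
    List.getD_append _ _ _ _ hi
  have B : ∀ i, r.length ≤ i → (r ++ l).getD i 0 = l.getD (i - r.length) 0 := fun i hi =>
    List.getD_append_right _ _ _ _ hi
  have B' : ∀ i, (r ++ l).getD (r.length + i) 0 = l.getD i 0 := fun i => by
    rw [B _ (by omega)]; congr 1; omega
  have J : ∀ i, i + 1 = r.length → l ≠ [] → (r ++ l).getD (i+1) 0 < (r ++ l).getD i 0 := by
    intro i hi hl
    rw [A i (by omega), B (i+1) (by omega)]
    have := hj hl
    rw [← hi] at this ⊢
    simpa using this
  have hlen : (r ++ l).length = r.length + l.length := List.length_append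
  have lpos : l ≠ [] ↔ 0 < l.length := List.length_pos_iff.symm
  constructor
  · rintro ⟨h1, h2⟩
    refine ⟨?_, ⟨?_, ?_⟩, ?_⟩
    · by_contra hc
      obtain ⟨j, hj, hle⟩ := h2 0 (by omega)
      rw [A _ (by omega), A _ (by omega)] at hle
      have := sorted_getD hr (by omega : 0 + j < 0 + j + 1) (by omega)
      omega
    · intro i hi
      have := h1 (r.length + i) (by omega)
      simpa only [add_assoc, B'] using this
    · intro i hi
      obtain ⟨j, hj, hle⟩ := h2 (r.length + i) (by omega)
      refine ⟨j, hj, ?_⟩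
      simpa only [add_assoc, B'] using hle
    · intro hl
      rw [gd_sorted hr _ _ h0]
      refine ⟨hj hl, fun h2r ⟨hl2, hlt⟩ => ?_⟩
      have h := h1 (r.length - 2) (by omega)
      have e1 : r.length - 2 + 1 = r.length - 1 := by omega
      have e2 : r.length - 2 + 2 = r.length + 0 := by omega
      have e3 : r.length - 2 + 3 = r.length + 1 := by omega
      rw [e1, e2, e3, B', B', A _ (by omega), A _ (by omega)] at h
      have i1 := sorted_getD hr (by omega : r.length - 2 < r.length - 1) (by omega)
      have i2 := hj hl
      have hne : r.getD (r.length - 2) 0 ≠ l.getD 0 0 := by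
        rw [List.nodup_append] at hnd
        apply hnd.2.2
        · rw [← List.mem_toFinset]; exact getD_mem_toFinset (by omega)
        · rw [← List.mem_toFinset]; exact getD_mem_toFinset (by omega)
      omega
  · rintro ⟨hrs, ⟨h1, h2⟩, h3⟩
    constructor
    · rintro i hi ⟨c1, c2, c3, c4⟩
      rcases Nat.lt_trichotomy (i+2) r.length with h | h | h
      · rw [A _ h, A _ (by omega)] at c2
        have := sorted_getD hr (by omega : i + 1 < i + 2) (by omega)
        omega
      · have hl : l ≠ [] := lpos.2 (by omega)
        have := ((gd_sorted hr _ _ h0).1 (h3 hl)).2 (by omega)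
        rw [B (i+2) (by omega), B (i+3) (by omega), show i + 2 - r.length = 0 by omega,
          show i + 3 - r.length = 1 by omega] at c3
        have := this ⟨by omega, c3⟩
        rw [B (i+2) (by omega), A i (by omega), show i + 2 - r.length = 0 by omega] at c4
        rw [show r.length - 2 = i by omega] at this
        omega
      · have hl : l ≠ [] := lpos.2 (by omega)
        by_cases hh : i + 1 = r.length
        · have := J i hh hl
          omega
        · obtain ⟨k, rfl⟩ := Nat.exists_eq_add_of_le (by omega : r.length ≤ i)
          simp only [add_assoc, B'] at c1 c2 c3 c4
          exact h1 k (by omega) ⟨c1, c2, c3, c4⟩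
    · intro i hi
      by_cases hir : r.length ≤ i
      · obtain ⟨k, rfl⟩ := Nat.exists_eq_add_of_le hir
        obtain ⟨j, hj, hle⟩ := h2 k (by omega)
        refine ⟨j, hj, ?_⟩
        simpa only [add_assoc, B'] using hle
      · have hl : l ≠ [] := lpos.2 (by omega)
        refine ⟨r.length - 1 - i, by omega, ?_⟩
        have := J (i + (r.length - 1 - i)) (by omega) hl
        omega

lemma desL_cons_cons (a b : ℕ) (t : List ℕ) :
    desL (a :: b :: t) = desL (b :: t) + if b < a then 1 else 0 := by
  simp [desL, List.countP_cons]

/-- The weight of a list. -/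
noncomputable def wt (l : List ℕ) : Polynomial ℚ := if l = [] then 1 else X ^ (1 + desL l)

lemma wt_append (r l : List ℕ) (hr : r.Pairwise (· < ·)) (h0 : r ≠ [])
    (hj : l ≠ [] → l.getD 0 0 < r.getD (r.length - 1) 0) : wt (r ++ l) = X * wt l := by
  induction r with
  | nil => exact absurd rfl h0
  | cons a t ih =>
    cases t with
    | nil =>
      cases l with
      | nil => simp [wt, desL]
      | cons b u =>
        have : b < a := by simpa using hj
        simp [wt, desL_cons_cons, this]
        ring
    | cons c t =>
      have h1 := ih (List.pairwise_cons.1 hr).2 (by simp) (by simpa using hj)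
      have hac : a < c := (List.pairwise_cons.1 hr).1 c (by simp)
      rw [← h1]
      simp [wt, desL_cons_cons, hac.not_gt]

lemma exists_run (l : List ℕ) (hl : l ≠ []) (hn : l.Nodup) : ∃ r t : List ℕ, l = r ++ t ∧
    r.Pairwise (· < ·) ∧ r ≠ [] ∧ (t ≠ [] → t.getD 0 0 < r.getD (r.length - 1) 0) := by
  induction l with
  | nil => exact absurd rfl hl
  | cons a u ih =>
    cases u with
    | nil => exact ⟨[a], [], by simp⟩
    | cons b u =>
      obtain ⟨r, t, h1, h2, h3, h4⟩ := ih (by simp) (List.nodup_cons.1 hn).2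
      obtain ⟨c, r, rfl⟩ := List.exists_cons_of_ne_nil h3
      obtain rfl : b = c := by simpa using (List.cons.inj h1).1
      by_cases hab : a < b
      · refine ⟨a :: b :: r, t, by rw [h1]; rfl, ?_, by simp, by simpa using h4⟩
        rw [List.pairwise_cons]
        refine ⟨fun x hx => ?_, h2⟩
        rcases List.mem_cons.1 hx with rfl | hx
        · exact hab
        · exact hab.trans ((List.pairwise_cons.1 h2).1 x hx)
      · refine ⟨[a], b :: u, by simp, by simp, by simp, ?_⟩
        have : a ≠ b := by
          rintro rfl; simp at hn
        simp; omega

lemma run_unique (r t r' t' : List ℕ) (h : r ++ t = r' ++ t') (hr' : r'.Pairwise (· < ·))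
    (h0 : r ≠ []) (hj : t ≠ [] → t.getD 0 0 < r.getD (r.length - 1) 0) : r'.length ≤ r.length := by
  by_contra hc
  push Not at hc
  have hpos : 0 < r.length := List.length_pos_iff.2 h0
  have hlen := congrArg List.length h
  simp only [List.length_append] at hlen
  have ht : t ≠ [] := List.length_pos_iff.1 (by omega)
  have h1 := hj ht
  have e1 : r.getD (r.length - 1) 0 = r'.getD (r.length - 1) 0 := by
    rw [← List.getD_append r t 0 _ (by omega), h, List.getD_append _ _ _ _ (by omega)]
  have e2 : t.getD 0 0 = r'.getD r.length 0 := by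
    rw [← List.getD_append r' t' 0 _ (by omega), ← h, List.getD_append_right _ _ _ _ (by omega)]
    simp
  have := sorted_getD hr' (by omega : r.length - 1 < r.length) hc
  omega

open scoped Classical in
/-- Weighted sum over avoiding lists on `S`. -/
noncomputable def NM (s : ℕ) (S : Finset ℕ) : Polynomial ℚ :=
  ∑ l ∈ (Lst S).filter (fun l => Av s l), wt l

open scoped Classical in
/-- Weighted sum over avoiding lists on `S` allowed after `R`. -/
noncomputable def GG (s : ℕ) (R S : Finset ℕ) : Polynomial ℚ :=
  ∑ l ∈ (Lst S).filter (fun l => Av s l ∧ goodL R l), wt l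

open scoped Classical in
lemma split_sum (s : ℕ) (hs : 2 ≤ s) (S : Finset ℕ) (hS : S.Nonempty)
    (P : List ℕ → Prop) (Q : Finset ℕ → Prop)
    (hPQ : ∀ r l : List ℕ, r.Pairwise (· < ·) → r ≠ [] →
      (l ≠ [] → l.getD 0 0 < r.getD (r.length - 1) 0) → (P (r ++ l) ↔ Q r.toFinset)) :
    ∑ l ∈ (Lst S).filter (fun l => Av s l ∧ P l), wt l =
      ∑ R ∈ S.powerset.filter (fun R => R.Nonempty ∧ R.card ≤ s ∧ Q R), X * GG s R (S \ R) := by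
  simp only [GG, Finset.mul_sum]
  rw [Finset.sum_sigma']
  symm
  have srt : ∀ R : Finset ℕ, (R.sort (· ≤ ·)).Pairwise (· < ·) := fun R => by
    exact (Finset.sortedLT_sort R).pairwise
  have main : ∀ a : (_ : Finset ℕ) × List ℕ, a ∈ ((S.powerset.filter
      (fun R => R.Nonempty ∧ R.card ≤ s ∧ Q R)).sigma
      (fun R => (Lst (S \ R)).filter (fun l => Av s l ∧ goodL R l))) →
      (a.1.Nonempty ∧ a.1.card ≤ s ∧ Q a.1 ∧ a.1 ⊆ S) ∧ (a.1.sort (· ≤ ·)) ≠ [] ∧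
      (a.2 ≠ [] → a.2.getD 0 0 < (a.1.sort (· ≤ ·)).getD ((a.1.sort (· ≤ ·)).length - 1) 0) ∧
      a.2.Nodup ∧ a.2.toFinset = S \ a.1 ∧ Av s a.2 ∧ goodL a.1 a.2 := by
    rintro ⟨R, l⟩ ha
    simp only [Finset.mem_sigma, Finset.mem_filter, Finset.mem_powerset, mem_Lst] at ha
    obtain ⟨⟨hRS, hR, hc, hQ⟩, ⟨hn, hl⟩, hav, hg⟩ := ha
    have hne : R.sort (· ≤ ·) ≠ [] := by
      intro h
      have := congrArg List.length h
      simp at this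
      exact hR.ne_empty this
    refine ⟨⟨hR, hc, hQ, hRS⟩, hne, fun hl0 => ?_, hn, hl, hav, hg⟩
    have := hg hl0
    have h2 : (R.sort (· ≤ ·)).toFinset = R := Finset.sort_toFinset R _
    dsimp only
    rw [← h2, gd_sorted (srt R) _ _ hne] at this
    exact this.1
  refine Finset.sum_bij (fun a _ => a.1.sort (· ≤ ·) ++ a.2) ?_ ?_ ?_ ?_
  · rintro a ha
    obtain ⟨⟨hR, hc, hQ, hRS⟩, hne, hj, hn, hl, hav, hg⟩ := main a ha
    have hnd : (a.1.sort (· ≤ ·) ++ a.2).Nodup := by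
      rw [List.nodup_append]
      refine ⟨Finset.sort_nodup _ _, hn, ?_⟩
      intro x hx y hy hxy
      subst hxy
      rw [← List.mem_toFinset, hl] at hy
      rw [Finset.mem_sort] at hx
      exact (Finset.mem_sdiff.1 hy).2 hx
    rw [Finset.mem_filter, mem_Lst]
    refine ⟨⟨hnd, ?_⟩, ?_, ?_⟩
    · rw [List.toFinset_append, Finset.sort_toFinset, hl]
      exact Finset.union_sdiff_of_subset hRS
    · rw [Av_append s hs _ _ (srt _) hne hnd hj]
      refine ⟨by simpa using hc, hav, ?_⟩
      rw [Finset.sort_toFinset]; exact hg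
    · rw [hPQ _ _ (srt _) hne hj, Finset.sort_toFinset]; exact hQ
  · rintro ⟨R, l⟩ ha ⟨R', l'⟩ ha' heq
    obtain ⟨-, hne, hj, -⟩ := main _ ha
    obtain ⟨-, hne', hj', -⟩ := main _ ha'
    dsimp only at *
    have l1 := run_unique _ _ _ _ heq (srt R') hne hj
    have l2 := run_unique _ _ _ _ heq.symm (srt R) hne' hj'
    obtain ⟨e1, e2⟩ := List.append_inj heq (by omega)
    have : R = R' := by
      rw [← Finset.sort_toFinset R (· ≤ ·), e1, Finset.sort_toFinset]
    subst this; subst e2; rfl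
  · intro l hl
    rw [Finset.mem_filter, mem_Lst] at hl
    obtain ⟨⟨hn, hlS⟩, hav, hP⟩ := hl
    have hl0 : l ≠ [] := by
      rintro rfl
      simp at hlS
      exact hS.ne_empty hlS.symm
    obtain ⟨r, t, rfl, hr, hr0, hj⟩ := exists_run l hl0 hn
    rw [Av_append s hs r t hr hr0 hn hj] at hav
    have hsort : r.toFinset.sort (· ≤ ·) = r := by
      apply List.Perm.eq_of_pairwise (le := (· ≤ ·))
      · intro a b _ _ h1 h2; exact le_antisymm h1 h2
      · exact (srt _).imp le_of_lt
      · exact hr.imp le_of_lt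
      · rw [List.perm_ext_iff_of_nodup (Finset.sort_nodup _ _) (List.nodup_append.1 hn).1]
        simp
    refine ⟨⟨r.toFinset, t⟩, ?_, by simp only [hsort]⟩
    simp only [Finset.mem_sigma, Finset.mem_filter, Finset.mem_powerset, mem_Lst]
    rw [List.toFinset_append] at hlS
    refine ⟨⟨?_, ?_, ?_, ?_⟩, ⟨(List.nodup_append.1 hn).2.1, ?_⟩, hav.2⟩
    · rw [← hlS]; exact Finset.subset_union_left
    · rw [List.toFinset_nonempty_iff]; exact hr0
    · rw [List.toFinset_card_of_nodup (List.nodup_append.1 hn).1]; exact hav.1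
    · exact (hPQ r t hr hr0 hj).1 hP
    · rw [← hlS, Finset.union_sdiff_left, Finset.sdiff_eq_self_of_disjoint]
      rw [Finset.disjoint_left]
      intro x hx hx'
      exact (List.nodup_append.1 hn).2.2 x (List.mem_toFinset.1 hx') x (List.mem_toFinset.1 hx) rfl
  · rintro a ha
    obtain ⟨-, hne, hj, -⟩ := main a ha
    exact (wt_append _ _ (srt _) hne hj).symm

/-! ### Clusters -/

/-- The solution of the recurrence. -/
noncomputable def vv (s : ℕ) : ℕ → Polynomial ℚ
  | 0 => 1
  | n + 1 => -X * vv s n - ∑ k ∈ Finset.range (s - 1),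
      (((n - k : ℕ) : Polynomial ℚ) * X * vv s (n - 1 - k) +
        ((n - 1 - k : ℕ) : Polynomial ℚ) * X ^ 2 * vv s (n - 2 - k))
  termination_by n => n
  decreasing_by all_goals omega

lemma vv_zero (s : ℕ) : vv s 0 = 1 := by rw [vv]

open scoped Classical in
/-- Signed sum over clusters on `S` continuing the brick `R`. -/
noncomputable def Clu (s : ℕ) (R S : Finset ℕ) : Polynomial ℚ :=
  if ∀ x ∈ R, ∀ z ∈ S, x ≤ z then vv s S.card
  else if 2 ≤ R.card ∧ ∀ x ∈ R, ∀ z ∈ R, x < z → ∀ u ∈ S, x ≤ u then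
    vv s S.card + X * vv s (S.card - 1)
  else 0

/-- The minimum. -/
noncomputable def mn (S : Finset ℕ) : ℕ := sInf (S : Set ℕ)

lemma mn_mem {S : Finset ℕ} (h : S.Nonempty) : mn S ∈ S := by
  have := Nat.sInf_mem (s := (S : Set ℕ)) (by simpa using h)
  simpa [mn] using this

lemma mn_le {S : Finset ℕ} {x : ℕ} (h : x ∈ S) : mn S ≤ x :=
  Nat.sInf_le (by simpa using h)

lemma mn_eq {S : Finset ℕ} {x : ℕ} (h : x ∈ S) (h2 : ∀ y ∈ S, x ≤ y) : mn S = x :=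
  le_antisymm (mn_le h) (h2 _ (mn_mem ⟨x, h⟩))

lemma exists_initial (S : Finset ℕ) (j : ℕ) (hj : j ≤ S.card) :
    ∃ I ⊆ S, I.card = j ∧ ∀ a ∈ I, ∀ b ∈ S \ I, a < b := by
  induction j with
  | zero => exact ⟨∅, by simp, by simp, by simp⟩
  | succ j ih =>
    obtain ⟨I, h1, h2, h3⟩ := ih (by omega)
    have hne : (S \ I).Nonempty := by
      rw [← Finset.card_pos, Finset.card_sdiff_of_subset h1]; omega
    have hm := mn_mem hne
    have hm' := Finset.mem_sdiff.1 hm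
    refine ⟨insert (mn (S \ I)) I, ?_, ?_, ?_⟩
    · exact Finset.insert_subset hm'.1 h1
    · rw [Finset.card_insert_of_notMem hm'.2, h2]
    · intro a ha b hb
      simp only [Finset.mem_sdiff, Finset.mem_insert, not_or] at hb
      rcases Finset.mem_insert.1 ha with rfl | ha
      · have := mn_le (Finset.mem_sdiff.2 ⟨hb.1, hb.2.2⟩)
        omega
      · exact h3 a ha b (Finset.mem_sdiff.2 ⟨hb.1, hb.2.2⟩)

lemma sum_big (s n m : ℕ) (S : Finset ℕ) (hS : S.card = n + 1) (h2 : 2 ≤ m) (hm : m ≤ n + 1) :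
    ∑ R ∈ S.powersetCard m, Clu s R (S \ R) =
      ((n + 2 - m : ℕ) : Polynomial ℚ) * vv s (n + 1 - m) +
      ((n + 1 - m : ℕ) : Polynomial ℚ) * (X * vv s (n - m)) := by
  obtain ⟨I, hIS, hIc, hI⟩ := exists_initial S (m - 1) (by omega)
  have hKc : (S \ I).card = n + 2 - m := by
    rw [Finset.card_sdiff_of_subset hIS]; omega
  have hne : (S \ I).Nonempty := by rw [← Finset.card_pos]; omega
  have hinj : Set.InjOn (fun x => insert x I) (S \ I : Finset ℕ) := by
    intro x hx y hy hxy
    have hx' := (Finset.mem_sdiff.1 (Finset.mem_coe.1 hx)).2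
    have : x ∈ insert y I := by rw [← show insert x I = insert y I from hxy]; simp
    rcases Finset.mem_insert.1 this with h | h
    · exact h
    · exact absurd h hx'
  have hsub : (S \ I).image (fun x => insert x I) ⊆ S.powersetCard m := by
    intro R hR
    obtain ⟨x, hx, rfl⟩ := Finset.mem_image.1 hR
    have hx := Finset.mem_sdiff.1 hx
    rw [Finset.mem_powersetCard]
    refine ⟨Finset.insert_subset hx.1 hIS, ?_⟩
    rw [Finset.card_insert_of_notMem hx.2]; omega
  rw [← Finset.sum_subset hsub, Finset.sum_image hinj]
  · have hval : ∀ x ∈ S \ I, Clu s (insert x I) (S \ insert x I) =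
        vv s (n + 1 - m) + if x = mn (S \ I) then 0 else X * vv s (n - m) := by
      intro x hx
      have hx' := Finset.mem_sdiff.1 hx
      have hc : (insert x I).card = m := by
        rw [Finset.card_insert_of_notMem hx'.2]; omega
      have hc2 : (S \ insert x I).card = n + 1 - m := by
        rw [Finset.card_sdiff_of_subset (Finset.insert_subset hx'.1 hIS)]; omega
      have cond2 : 2 ≤ (insert x I).card ∧ ∀ a ∈ insert x I, ∀ z ∈ insert x I, a < z →
          ∀ u ∈ S \ insert x I, a ≤ u := by
        refine ⟨by omega, fun a ha z hz haz u hu => ?_⟩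
        simp only [Finset.mem_sdiff, Finset.mem_insert, not_or] at hu
        rcases Finset.mem_insert.1 ha with rfl | ha
        · rcases Finset.mem_insert.1 hz with rfl | hz
          · omega
          · have := hI z hz a hx
            omega
        · exact (hI a ha u (Finset.mem_sdiff.2 ⟨hu.1, hu.2.2⟩)).le
      have cond1 : (∀ a ∈ insert x I, ∀ z ∈ S \ insert x I, a ≤ z) ↔ x = mn (S \ I) := by
        constructor
        · intro h
          refine (mn_eq hx fun y hy => ?_).symm
          by_cases hxy : y = x
          · rw [hxy]
          · refine h x (by simp) y ?_
            have := Finset.mem_sdiff.1 hy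
            simp [this, hxy]
        · intro h a ha u hu
          simp only [Finset.mem_sdiff, Finset.mem_insert, not_or] at hu
          have hu2 := Finset.mem_sdiff.2 ⟨hu.1, hu.2.2⟩
          rcases Finset.mem_insert.1 ha with rfl | ha
          · rw [h]; exact mn_le hu2
          · exact (hI a ha u hu2).le
      unfold Clu
      rw [if_pos cond2, hc2, show n + 1 - m - 1 = n - m by omega]
      by_cases hxm : x = mn (S \ I)
      · rw [if_pos (cond1.2 hxm), if_pos hxm, add_zero]
      · rw [if_neg (fun h => hxm (cond1.1 h)), if_neg hxm]
    rw [Finset.sum_congr rfl hval, Finset.sum_add_distrib, Finset.sum_const, hKc]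
    congr 1
    · simp
    · rw [← Finset.add_sum_erase _ _ (mn_mem hne), if_pos rfl, zero_add]
      rw [Finset.sum_congr rfl (g := fun _ => X * vv s (n - m))]
      · rw [Finset.sum_const, Finset.card_erase_of_mem (mn_mem hne), hKc, nsmul_eq_mul]
        congr 2
        omega
      · intro x hx
        rw [if_neg (Finset.mem_erase.1 hx).1]
  · intro R hR hRn
    rw [Finset.mem_powersetCard] at hR
    obtain ⟨hRS, hRc⟩ := hR
    by_contra hC
    have cond2 : ∀ x ∈ R, ∀ z ∈ R, x < z → ∀ u ∈ S \ R, x ≤ u := by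
      unfold Clu at hC
      split_ifs at hC with c1 c2
      · exact fun x hx _ _ _ u hu => c1 x hx u hu
      · exact c2.2
      · exact absurd rfl hC
    apply hRn
    have hRne : R.Nonempty := by rw [← Finset.card_pos]; omega
    have hzR := Finset.max'_mem R hRne
    set z := R.max' hRne with hz
    have hlt : ∀ x ∈ R.erase z, x < z := fun x hx =>
      lt_of_le_of_ne (Finset.le_max' R x (Finset.mem_of_mem_erase hx)) (Finset.ne_of_mem_erase hx)
    have hec : (R.erase z).card = I.card := by
      rw [Finset.card_erase_of_mem hzR]; omega
    have hIe : I = R.erase z := by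
      apply Finset.eq_of_subset_of_card_le _ hec.le
      intro y hy
      by_contra hyn
      have : ¬ (R.erase z ⊆ I) := fun h => by
        have := Finset.eq_of_subset_of_card_le h hec.ge
        rw [this] at hyn
        exact hyn hy
      obtain ⟨x, hx, hxI⟩ := Finset.not_subset.1 this
      have hxR := Finset.mem_of_mem_erase hx
      have hyx := hI y hy x (Finset.mem_sdiff.2 ⟨hRS hxR, hxI⟩)
      by_cases hyz : y = z
      · have := hlt x hx
        omega
      · have hyR : y ∉ R := fun h => hyn (Finset.mem_erase.2 ⟨hyz, h⟩)
        have := cond2 x hxR z hzR (hlt x hx) y (Finset.mem_sdiff.2 ⟨hIS hy, hyR⟩)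
        omega
    rw [Finset.mem_image]
    refine ⟨z, ?_, ?_⟩
    · rw [Finset.mem_sdiff, hIe]
      exact ⟨hRS hzR, by simp⟩
    · rw [hIe]; exact Finset.insert_erase hzR

lemma sum_small (s n : ℕ) (S : Finset ℕ) (hS : S.card = n + 1) :
    ∑ R ∈ S.powersetCard 1, Clu s R (S \ R) = vv s n := by
  have hne : S.Nonempty := by rw [← Finset.card_pos]; omega
  rw [Finset.powersetCard_one, Finset.sum_map]
  have : ∀ x ∈ S, Clu s {x} (S \ {x}) = if x = mn S then vv s n else 0 := by
    intro x hx
    have hc : (S \ {x}).card = n := by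
      rw [Finset.card_sdiff_of_subset (by simpa using hx)]; simp; omega
    unfold Clu
    have c1 : (∀ a ∈ ({x} : Finset ℕ), ∀ z ∈ S \ {x}, a ≤ z) ↔ x = mn S := by
      constructor
      · intro h
        refine (mn_eq hx fun y hy => ?_).symm
        by_cases hxy : y = x
        · rw [hxy]
        · exact h x (by simp) y (by simp [hy, hxy])
      · rintro h a ha z hz
        rw [Finset.mem_singleton] at ha
        rw [ha, h]
        exact mn_le (Finset.mem_sdiff.1 hz).1
    by_cases hx : x = mn S
    · rw [if_pos (c1.2 hx), if_pos hx, hc]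
    · rw [if_neg (fun h => hx (c1.1 h)), if_neg hx, if_neg]
      simp
  refine (Finset.sum_congr rfl this).trans ?_
  rw [Finset.sum_ite_eq' S (mn S), if_pos (mn_mem hne)]

open scoped Classical in
lemma sum_bigs (s n : ℕ) (S : Finset ℕ) (hS : S.card = n + 1) :
    -X * ∑ R ∈ S.powerset.filter (fun R => (R.Nonempty ∧ R.card ≤ s) ∧ 2 ≤ R.card), Clu s R (S \ R) =
      vv s (n + 1) + X * vv s n := by
  have h1 : ∑ R ∈ S.powerset.filter (fun R => (R.Nonempty ∧ R.card ≤ s) ∧ 2 ≤ R.card),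
      Clu s R (S \ R) = ∑ k ∈ Finset.range (s - 1), ∑ R ∈ S.powersetCard (k + 2), Clu s R (S \ R) := by
    rw [← Finset.sum_fiberwise_of_maps_to (g := fun R => R.card - 2) (t := Finset.range (s - 1))]
    · refine Finset.sum_congr rfl fun k hk => Finset.sum_congr ?_ fun _ _ => rfl
      rw [Finset.mem_range] at hk
      ext R
      simp only [Finset.mem_filter, Finset.mem_powerset, Finset.mem_powersetCard]
      constructor
      · rintro ⟨⟨h1, h2, h3⟩, h4⟩
        exact ⟨h1, by omega⟩
      · rintro ⟨h1, h2⟩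
        refine ⟨⟨h1, ⟨?_, by omega⟩, by omega⟩, by omega⟩
        rw [← Finset.card_pos]; omega
    · intro R hR
      simp only [Finset.mem_filter] at hR
      rw [Finset.mem_range]
      omega
  rw [h1]
  have h2 : ∀ k ∈ Finset.range (s - 1), ∑ R ∈ S.powersetCard (k + 2), Clu s R (S \ R) =
      ((n - k : ℕ) : Polynomial ℚ) * vv s (n - 1 - k) +
        ((n - 1 - k : ℕ) : Polynomial ℚ) * (X * vv s (n - 2 - k)) := by
    intro k _
    by_cases hk : k + 2 ≤ n + 1
    · rw [sum_big s n (k + 2) S hS (by omega) hk]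
      rw [show n + 2 - (k + 2) = n - k by omega, show n + 1 - (k + 2) = n - 1 - k by omega,
        show n - (k + 2) = n - 2 - k by omega]
    · rw [Finset.powersetCard_eq_empty.2 (by omega), show n - k = 0 by omega,
        show n - 1 - k = 0 by omega]
      simp
  rw [Finset.sum_congr rfl h2, vv, Finset.mul_sum]
  have : ∀ a b c : Polynomial ℚ, a = - b → a = -X * c - b + X * c := by
    intro a b c h; rw [h]; ring
  apply this
  rw [← Finset.sum_neg_distrib]
  refine Finset.sum_congr rfl fun k _ => ?_
  ring

lemma Clu_support (s : ℕ) (S R : Finset ℕ) (hR : R.Nonempty) (hRS : R ⊆ S)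
    (h : Clu s R (S \ R) ≠ 0) : mn R = mn S := by
  have hS := hR.mono hRS
  have key : mn S ∈ R := by
    by_contra hn
    have hu := Finset.mem_sdiff.2 ⟨mn_mem hS, hn⟩
    have : ∃ x ∈ R, x ≤ mn S := by
      unfold Clu at h
      split_ifs at h with c1 c2
      · obtain ⟨x, hx⟩ := hR
        exact ⟨x, hx, c1 x hx _ hu⟩
      · obtain ⟨x, hx, y, hy, hxy⟩ := Finset.one_lt_card.1 c2.1
        rcases lt_or_gt_of_ne hxy with hl | hl
        · exact ⟨x, hx, c2.2 x hx y hy hl _ hu⟩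
        · exact ⟨y, hy, c2.2 y hy x hx hl _ hu⟩
      · exact absurd rfl h
    obtain ⟨x, hx, hle⟩ := this
    have := mn_le (hRS hx)
    have he : x = mn S := by omega
    exact hn (he ▸ hx)
  exact mn_eq key fun y hy => mn_le (hRS hy)

open scoped Classical in
lemma Clu_rec (s : ℕ) (hs : 2 ≤ s) (R S : Finset ℕ) (hS : S.Nonempty) :
    Clu s R S = -X * ∑ R' ∈ S.powerset.filter
      (fun R' => R'.Nonempty ∧ R'.card ≤ s ∧ ¬ gd R (2 ≤ R'.card) (mn R')), Clu s R' (S \ R') := by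
  obtain ⟨n, hn⟩ : ∃ n, S.card = n + 1 := ⟨S.card - 1, by
    have := Finset.card_pos.2 hS; omega⟩
  have big := sum_bigs s n S hn
  have small := sum_small s n S hn
  have e1 : ∑ R' ∈ S.powerset.filter
      (fun R' => R'.Nonempty ∧ R'.card ≤ s ∧ ¬ gd R (2 ≤ R'.card) (mn R')), Clu s R' (S \ R') =
      (if gd R True (mn S) then 0 else
        ∑ R ∈ S.powerset.filter (fun R => (R.Nonempty ∧ R.card ≤ s) ∧ 2 ≤ R.card), Clu s R (S \ R)) +
      (if gd R False (mn S) then 0 else ∑ R ∈ S.powersetCard 1, Clu s R (S \ R)) := by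
    have hsm : S.powersetCard 1 =
        S.powerset.filter (fun R => (R.Nonempty ∧ R.card ≤ s) ∧ ¬ 2 ≤ R.card) := by
      ext R
      simp only [Finset.mem_filter, Finset.mem_powerset, Finset.mem_powersetCard,
        ← Finset.card_pos]
      constructor
      · rintro ⟨h1, h2⟩; exact ⟨h1, by omega⟩
      · rintro ⟨h1, h2⟩; exact ⟨h1, by omega⟩
    have : S.powerset.filter
        (fun R' => R'.Nonempty ∧ R'.card ≤ s ∧ ¬ gd R (2 ≤ R'.card) (mn R')) =
        (S.powerset.filter (fun R' => R'.Nonempty ∧ R'.card ≤ s)).filter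
          (fun R' => ¬ gd R (2 ≤ R'.card) (mn R')) := by
      rw [Finset.filter_filter]; simp only [and_assoc]
    rw [this, Finset.sum_filter, hsm]
    rw [← Finset.sum_filter_add_sum_filter_not _ (fun R' : Finset ℕ => 2 ≤ R'.card)]
    rw [Finset.filter_filter, Finset.filter_filter]
    congr 1
    · have : ∀ R' ∈ S.powerset.filter (fun R => (R.Nonempty ∧ R.card ≤ s) ∧ 2 ≤ R.card),
          (if ¬ gd R (2 ≤ R'.card) (mn R') then Clu s R' (S \ R') else 0) =
          if gd R True (mn S) then 0 else Clu s R' (S \ R') := by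
        intro R' hR'
        simp only [Finset.mem_filter, Finset.mem_powerset] at hR'
        obtain ⟨h1, ⟨h2, h3⟩, h4⟩ := hR'
        by_cases hC : Clu s R' (S \ R') = 0
        · simp [hC]
        · rw [Clu_support s S R' h2 h1 hC]
          simp only [h4, ite_not]
      rw [Finset.sum_congr rfl this]
      split_ifs <;> simp
    · have : ∀ R' ∈ S.powerset.filter (fun R => (R.Nonempty ∧ R.card ≤ s) ∧ ¬ 2 ≤ R.card),
          (if ¬ gd R (2 ≤ R'.card) (mn R') then Clu s R' (S \ R') else 0) =
          if gd R False (mn S) then 0 else Clu s R' (S \ R') := by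
        intro R' hR'
        simp only [Finset.mem_filter, Finset.mem_powerset] at hR'
        obtain ⟨h1, ⟨h2, h3⟩, h4⟩ := hR'
        by_cases hC : Clu s R' (S \ R') = 0
        · simp [hC]
        · rw [Clu_support s S R' h2 h1 hC]
          simp only [h4, ite_not]
      rw [Finset.sum_congr rfl this]
      split_ifs <;> simp
  rw [e1, mul_add]
  have g1 : (∀ x ∈ R, ∀ z ∈ S, x ≤ z) ↔ ¬ gd R False (mn S) := by
    unfold gd
    constructor
    · rintro h ⟨⟨x, hx, hlt⟩, -⟩
      have := h x hx _ (mn_mem hS)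
      omega
    · intro h x hx z hz
      by_contra hc
      exact h ⟨⟨x, hx, lt_of_le_of_lt (mn_le hz) (not_le.1 hc)⟩, fun _ h => h.elim⟩
  have g2 : (2 ≤ R.card ∧ ∀ x ∈ R, ∀ z ∈ R, x < z → ∀ u ∈ S, x ≤ u) →  ¬ gd R True (mn S) := by
    rintro ⟨h1, h2⟩ ⟨-, h⟩
    obtain ⟨x, hx, z, hz, h3, h4⟩ := h h1 trivial
    have := h2 x hx z hz h4 _ (mn_mem hS)
    omega
  have g3 : gd R False (mn S) → ¬ (2 ≤ R.card ∧ ∀ x ∈ R, ∀ z ∈ R, x < z → ∀ u ∈ S, x ≤ u) →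
      gd R True (mn S) := by
    rintro ⟨h1, -⟩ h2
    refine ⟨h1, fun h3 _ => ?_⟩
    by_contra hc
    push Not at hc
    exact h2 ⟨h3, fun x hx z hz hxz u hu => by
      by_contra h
      have := hc x hx z hz (lt_of_le_of_lt (mn_le hu) (not_le.1 h))
      omega⟩
  have g4 : gd R True (mn S) → gd R False (mn S) := fun h => ⟨h.1, fun _ h => h.elim⟩
  unfold Clu
  by_cases hF : gd R False (mn S)
  · rw [if_neg (fun h => g1.1 h hF), if_pos hF]
    by_cases hc : 2 ≤ R.card ∧ ∀ x ∈ R, ∀ z ∈ R, x < z → ∀ u ∈ S, x ≤ u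
    · rw [if_pos hc, if_neg (g2 hc), hn]
      unfold Clu at big
      rw [big]; simp
    · rw [if_neg hc, if_pos (g3 hF hc)]; simp
  · rw [if_pos (g1.2 hF), if_neg hF, if_neg (fun h => hF (g4 h)), hn]
    unfold Clu at big small
    rw [big, small]; ring

lemma Lst_empty : Lst ∅ = {[]} := by
  ext l; rw [mem_Lst]
  simp only [List.toFinset_eq_empty_iff, Finset.mem_singleton]
  exact ⟨fun h => h.2, fun h => ⟨by rw [h]; simp, h⟩⟩

lemma Av_nil (s : ℕ) : Av s [] := ⟨fun i hi => by simp at hi, fun i hi => by simp at hi⟩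

lemma NM_empty (s : ℕ) : NM s ∅ = 1 := by
  simp [NM, Lst_empty, Finset.filter_singleton, Av_nil, wt]

lemma GG_empty (s : ℕ) (R : Finset ℕ) : GG s R ∅ = 1 := by
  have : goodL R [] := fun h => absurd rfl h
  simp [GG, Lst_empty, Finset.filter_singleton, Av_nil, wt, this]

lemma Clu_empty (s : ℕ) (R : Finset ℕ) : Clu s R ∅ = 1 := by
  simp [Clu, vv_zero]

lemma mn_sorted (r : List ℕ) (hr : r.Pairwise (· < ·)) (h0 : r ≠ []) :
    mn r.toFinset = r.getD 0 0 := by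
  have hpos : 0 < r.length := List.length_pos_iff.2 h0
  refine mn_eq (getD_mem_toFinset hpos) fun y hy => ?_
  obtain ⟨i, hi, rfl⟩ := exists_getD hy
  rcases Nat.eq_zero_or_pos i with h | h
  · rw [h]
  · exact (sorted_getD hr h hi).le

open scoped Classical in
lemma GG_rec (s : ℕ) (hs : 2 ≤ s) (R S : Finset ℕ) (hS : S.Nonempty) :
    GG s R S = ∑ R' ∈ S.powerset.filter
      (fun R' => R'.Nonempty ∧ R'.card ≤ s ∧ gd R (2 ≤ R'.card) (mn R')), X * GG s R' (S \ R') := by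
  conv_lhs => unfold GG
  apply split_sum s hs S hS
  intro r l hr h0 hj
  have hpos : 0 < r.length := List.length_pos_iff.2 h0
  have hnd : r.Nodup := hr.imp (fun h => ne_of_lt h)
  unfold goodL
  rw [mn_sorted r hr h0, List.toFinset_card_of_nodup hnd, List.getD_append _ _ _ _ hpos]
  have : (2 ≤ (r ++ l).length ∧ r.getD 0 0 < (r ++ l).getD 1 0) ↔ 2 ≤ r.length := by
    constructor
    · rintro ⟨h1, h2⟩
      by_contra hc
      have hr1 : r.length = 1 := by omega
      rw [List.getD_append_right _ _ _ _ (by omega), hr1] at h2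
      have := hj (List.length_pos_iff.1 (by rw [List.length_append] at h1; omega))
      rw [hr1] at this
      simp only [le_refl, Nat.sub_self] at h2 this
      omega
    · intro h
      refine ⟨by rw [List.length_append]; omega, ?_⟩
      rw [List.getD_append _ _ _ _ (by omega)]
      exact sorted_getD hr (by omega) (by omega)
  rw [this]
  simp [h0]

open scoped Classical in
lemma NM_rec (s : ℕ) (hs : 2 ≤ s) (S : Finset ℕ) (hS : S.Nonempty) :
    NM s S = ∑ R' ∈ S.powerset.filter
      (fun R' => R'.Nonempty ∧ R'.card ≤ s), X * GG s R' (S \ R') := by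
  have := split_sum s hs S hS (fun _ => True) (fun _ => True) (by simp)
  simpa [NM] using this

open scoped Classical in
lemma Clu_NM (s : ℕ) (hs : 2 ≤ s) (S : Finset ℕ) : ∀ R : Finset ℕ,
    ∑ T ∈ S.powerset, Clu s R T * NM s (S \ T) = GG s R S := by
  induction S using Finset.strongInduction with
  | H S ih =>
    intro R
    rcases S.eq_empty_or_nonempty with rfl | hS
    · simp [Clu_empty, NM_empty, GG_empty]
    · rw [← Finset.add_sum_erase _ _ (Finset.empty_mem_powerset S), Clu_empty]
      have e1 : ∑ T ∈ S.powerset.erase ∅, Clu s R T * NM s (S \ T) =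
          ∑ T ∈ S.powerset.erase ∅, ∑ R' ∈ T.powerset.filter
            (fun R' => R'.Nonempty ∧ R'.card ≤ s ∧ ¬ gd R (2 ≤ R'.card) (mn R')),
            -X * (Clu s R' (T \ R') * NM s (S \ T)) := by
        refine Finset.sum_congr rfl fun T hT => ?_
        rw [Clu_rec s hs R T (Finset.nonempty_iff_ne_empty.2 (Finset.mem_erase.1 hT).1),
          Finset.mul_sum, Finset.sum_mul]
        exact Finset.sum_congr rfl fun _ _ => by ring
      have e2 : ∑ T ∈ S.powerset.erase ∅, ∑ R' ∈ T.powerset.filter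
            (fun R' => R'.Nonempty ∧ R'.card ≤ s ∧ ¬ gd R (2 ≤ R'.card) (mn R')),
            -X * (Clu s R' (T \ R') * NM s (S \ T)) =
          ∑ R' ∈ S.powerset.filter
            (fun R' => R'.Nonempty ∧ R'.card ≤ s ∧ ¬ gd R (2 ≤ R'.card) (mn R')),
            ∑ T ∈ (S \ R').powerset, -X * (Clu s R' T * NM s ((S \ R') \ T)) := by
        rw [Finset.sum_sigma', Finset.sum_sigma']
        refine Finset.sum_bij' (fun a _ => ⟨a.2, a.1 \ a.2⟩) (fun a _ => ⟨a.1 ∪ a.2, a.1⟩) ?_ ?_ ?_ ?_ ?_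
        · rintro ⟨T, R'⟩ h
          simp only [Finset.mem_sigma, Finset.mem_erase, Finset.mem_filter,
            Finset.mem_powerset] at h ⊢
          exact ⟨⟨h.2.1.trans h.1.2, h.2.2⟩, Finset.sdiff_subset_sdiff h.1.2 le_rfl⟩
        · rintro ⟨R', T⟩ h
          simp only [Finset.mem_sigma, Finset.mem_erase, Finset.mem_filter,
            Finset.mem_powerset] at h ⊢
          refine ⟨⟨?_, Finset.union_subset h.1.1 (h.2.trans Finset.sdiff_subset)⟩,
            Finset.subset_union_left, h.1.2⟩
          exact (h.1.2.1.mono Finset.subset_union_left).ne_empty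
        · rintro ⟨T, R'⟩ h
          simp only [Finset.mem_sigma, Finset.mem_erase, Finset.mem_filter,
            Finset.mem_powerset] at h
          simp only [Finset.union_sdiff_of_subset h.2.1]
        · rintro ⟨R', T⟩ h
          simp only [Finset.mem_sigma, Finset.mem_filter, Finset.mem_powerset] at h
          have : (R' ∪ T) \ R' = T := by
            rw [Finset.union_sdiff_left, Finset.sdiff_eq_self_of_disjoint]
            rw [Finset.disjoint_left]
            exact fun x hx => (Finset.mem_sdiff.1 (h.2 hx)).2
          simp only [this]
        · rintro ⟨T, R'⟩ h
          simp only [Finset.mem_sigma, Finset.mem_erase, Finset.mem_filter,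
            Finset.mem_powerset] at h
          have : (S \ R') \ (T \ R') = S \ T := by
            ext x
            have := @h.2.1 x
            simp only [Finset.mem_sdiff]
            tauto
          simp only [this]
      have e3 : ∑ R' ∈ S.powerset.filter
            (fun R' => R'.Nonempty ∧ R'.card ≤ s ∧ ¬ gd R (2 ≤ R'.card) (mn R')),
            ∑ T ∈ (S \ R').powerset, -X * (Clu s R' T * NM s ((S \ R') \ T)) =
          - ∑ R' ∈ S.powerset.filter
            (fun R' => R'.Nonempty ∧ R'.card ≤ s ∧ ¬ gd R (2 ≤ R'.card) (mn R')),
            X * GG s R' (S \ R') := by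
        rw [← Finset.sum_neg_distrib]
        refine Finset.sum_congr rfl fun R' hR' => ?_
        simp only [Finset.mem_filter, Finset.mem_powerset] at hR'
        rw [← Finset.mul_sum, ih (S \ R') (Finset.sdiff_ssubset hR'.1 hR'.2.1) R']
        ring
      rw [e1, e2, e3, GG_rec s hs R S hS, Finset.sdiff_empty, one_mul, NM_rec s hs S hS]
      have := Finset.sum_filter_add_sum_filter_not
        (S.powerset.filter (fun R' => R'.Nonempty ∧ R'.card ≤ s))
        (fun R' => gd R (2 ≤ R'.card) (mn R')) (fun R' => X * GG s R' (S \ R'))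
      rw [Finset.filter_filter, Finset.filter_filter] at this
      simp only [and_assoc] at this
      rw [← this]; ring

lemma vv_NM (s : ℕ) (hs : 2 ≤ s) (S : Finset ℕ) (hS : S.Nonempty) :
    ∑ T ∈ S.powerset, vv s T.card * NM s (S \ T) = 0 := by
  have h := Clu_NM s hs S ∅
  have e : GG s ∅ S = 0 := by
    rw [GG_rec s hs ∅ S hS]
    simp [gd]
  rw [e] at h
  rw [← h]
  refine Finset.sum_congr rfl fun T _ => ?_
  simp [Clu]

lemma NM_card (s : ℕ) (hs : 2 ≤ s) (n : ℕ) : ∀ S : Finset ℕ, S.card = n →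
    NM s S = NM s (Finset.Icc 1 n) := by
  induction n using Nat.strong_induction_on with
  | _ n ih =>
    rcases Nat.eq_zero_or_pos n with rfl | hn
    · intro S hS
      rw [Finset.card_eq_zero.1 hS]; simp
    · have key : ∀ S : Finset ℕ, S.card = n → NM s S = NM s (Finset.Icc 1 n) -
          ∑ k ∈ Finset.range (n + 1), n.choose k • (vv s k * NM s (Finset.Icc 1 (n - k))) := by
        intro S hS
        have hne : S.Nonempty := by rw [← Finset.card_pos]; omega
        have h := vv_NM s hs S hne
        have h2 := Finset.sum_powerset_apply_card
          (x := S) (fun k => vv s k * NM s (Finset.Icc 1 (n - k)))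
        rw [hS] at h2
        rw [← Finset.add_sum_erase _ _ (Finset.empty_mem_powerset S)] at h h2
        rw [← h2]
        have e : ∑ T ∈ S.powerset.erase ∅, vv s T.card * NM s (S \ T) =
            ∑ T ∈ S.powerset.erase ∅, vv s T.card * NM s (Finset.Icc 1 (n - T.card)) := by
          refine Finset.sum_congr rfl fun T hT => ?_
          rw [Finset.mem_erase, Finset.mem_powerset] at hT
          have hp : 0 < T.card := Finset.card_pos.2 (Finset.nonempty_iff_ne_empty.2 hT.1)
          rw [ih (n - T.card) (by omega) (S \ T) (by rw [Finset.card_sdiff_of_subset hT.2, hS])]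
        rw [e] at h
        simp only [Finset.card_empty, vv_zero, one_mul, Finset.sdiff_empty, Nat.sub_zero] at h ⊢
        linear_combination h
      intro S hS
      rw [key S hS]
      exact (key (Finset.Icc 1 n) (by simp)).symm

lemma vv_conv (s : ℕ) (hs : 2 ≤ s) (n : ℕ) (hn : 1 ≤ n) :
    ∑ k ∈ Finset.range (n + 1), (n.choose k : ℚ) • (vv s k * NM s (Finset.Icc 1 (n - k))) = 0 := by
  have h := vv_NM s hs (Finset.Icc 1 n) (by simpa using hn)
  have h2 := Finset.sum_powerset_apply_card
    (x := Finset.Icc 1 n) (fun k => vv s k * NM s (Finset.Icc 1 (n - k)))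
  rw [Nat.card_Icc, Nat.add_sub_cancel] at h2
  have e : ∑ T ∈ (Finset.Icc 1 n).powerset, vv s T.card * NM s (Finset.Icc 1 n \ T) =
      ∑ T ∈ (Finset.Icc 1 n).powerset, vv s T.card * NM s (Finset.Icc 1 (n - T.card)) := by
    refine Finset.sum_congr rfl fun T hT => ?_
    rw [Finset.mem_powerset] at hT
    rw [NM_card s hs (n - T.card) _ (by rw [Finset.card_sdiff_of_subset hT]; simp)]
  rw [e, h2] at h
  rw [← h]
  refine Finset.sum_congr rfl fun k _ => ?_
  rw [Nat.cast_smul_eq_nsmul]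

open scoped Classical in
lemma NMpoly_eq (s : ℕ) (hs : 2 ≤ s) (n : ℕ) :
    NMpoly {[1, 3, 2, 4], [1, 4, 2, 3], List.range' 1 (s + 1)} n = NM s (Finset.Icc 1 n) := by
  unfold NMpoly
  rcases Nat.eq_zero_or_pos n with rfl | hn
  · simp [NM_empty]
  · rw [if_neg (by omega)]
    unfold NMfinset NM
    rw [Lst_Icc]
    refine Finset.sum_congr ?_ ?_
    · refine Finset.filter_congr fun l hl => ?_
      exact hasMatch_iff s hs l ((mem_Lst _ _).1 hl).1
    · intro l hl
      rw [Finset.mem_filter, mem_Lst] at hl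
      have : l ≠ [] := by
        rintro rfl
        have := hl.1.2
        have h1 : (1 : ℕ) ∈ Finset.Icc 1 n := by simp; omega
        rw [← this] at h1
        simp at h1
      rw [wt, if_neg this]

theorem stmt6 (s : ℕ) (hs : 2 ≤ s) (Γ : Set (List ℕ))
    (hΓ : Γ = {[1, 3, 2, 4], [1, 4, 2, 3], List.range' 1 (s + 1)})
    (U : ℤ → Polynomial ℚ)
    (hUneg : ∀ m : ℤ, m < 0 → U m = 0)
    (hU0 : U 0 = 1)
    (hUrec : ∀ n : ℕ, 1 ≤ n →
      ∑ k ∈ Finset.range (n + 1), (n.choose k : ℚ) • (U (k : ℤ) * NMpoly Γ (n - k)) = 0) :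
    U 1 = -X ∧ ∀ n : ℕ, 2 ≤ n →
      U (n : ℤ) = -X * U ((n : ℤ) - 1) -
        ∑ k ∈ Finset.range (s - 1),
          (Polynomial.C ((n : ℚ) - k - 1) * X * U ((n : ℤ) - k - 2) +
            Polynomial.C ((n : ℚ) - k - 2) * X ^ 2 * U ((n : ℤ) - k - 3)) := by
  subst hΓ
  have hUv : ∀ n : ℕ, U (n : ℤ) = vv s n := by
    intro n
    induction n using Nat.strong_induction_on with
    | _ n ih =>
      rcases Nat.eq_zero_or_pos n with rfl | hn
      · rw [vv_zero]; exact hU0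
      · have h1 := hUrec n hn
        have h2 := vv_conv s hs n hn
        rw [Finset.sum_range_succ] at h1 h2
        have e : ∑ k ∈ Finset.range n, (n.choose k : ℚ) • (U (k : ℤ) *
            NMpoly {[1, 3, 2, 4], [1, 4, 2, 3], List.range' 1 (s + 1)} (n - k)) =
            ∑ k ∈ Finset.range n, (n.choose k : ℚ) • (vv s k * NM s (Finset.Icc 1 (n - k))) := by
          refine Finset.sum_congr rfl fun k hk => ?_
          rw [ih k (Finset.mem_range.1 hk), NMpoly_eq s hs]
        rw [e, NMpoly_eq s hs] at h1
        simp only [Nat.choose_self, Nat.cast_one, one_smul, Nat.sub_self] at h1 h2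
        simp only [show Finset.Icc 1 0 = (∅ : Finset ℕ) by simp, NM_empty, mul_one] at h1 h2
        linear_combination h1 - h2
  constructor
  · have h := hUv 1
    rw [vv, vv_zero] at h
    simpa using h
  · intro n hn
    obtain ⟨m, rfl⟩ : ∃ m, n = m + 1 := ⟨n - 1, by omega⟩
    rw [hUv, vv]
    congr 1
    · rw [← hUv]; congr 2; push_cast; ring
    · refine Finset.sum_congr rfl fun k _ => ?_
      congr 1
      · by_cases hk : k + 1 ≤ m
        · rw [← hUv, ← Polynomial.C_eq_natCast]
          congr 2
          · congr 2
            push_cast [Nat.cast_sub (by omega : k ≤ m)]; ring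
          · omega
        · rw [hUneg _ (by push_cast; omega), show m - k = 0 by omega]
          simp
      · by_cases hk : k + 2 ≤ m
        · rw [← hUv, ← Polynomial.C_eq_natCast]
          congr 2
          · congr 2
            rw [show m - 1 - k = m - (k + 1) by omega, Nat.cast_sub (by omega : k + 1 ≤ m)]
            push_cast; ring
          · omega
        · rw [hUneg _ (by push_cast; omega), show m - 1 - k = 0 by omega]
          simp
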